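/- For an n×n integer matrix A with n ≥ 4 whose entries are bounded in absolute value by B > 1, every coefficient c of the characteristic polynomial of A satisfies |c| < 2^{⌈(n/2)(log₂(n) + log₂(B²) + 1.6669)⌉}. -/

import Mathlib

open Polynomial Matrix

lemma amgm_aux (n : ℕ) (x : Fin n → ℝ) (T : ℝ) (hT : 0 < T) (hx : ∀ i, 0 ≤ x i)
    (hs : ∑ i, x i ≤ n * T) : ∏ i, x i ≤ T ^ n := by
  have h1 : ∏ i, (x i / T) ≤ ∏ i, Real.exp (x i / T - 1) := by
    apply Finset.prod_le_prod
    · intro i _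
      exact div_nonneg (hx i) hT.le
    · intro i _
      have := Real.add_one_le_exp (x i / T - 1)
      linarith
  rw [← Real.exp_sum, Finset.prod_div_distrib, Finset.sum_sub_distrib, ← Finset.sum_div] at h1
  have h2 : Real.exp ((∑ i, x i) / T - ∑ i : Fin n, (1 : ℝ)) ≤ 1 := by
    rw [Real.exp_le_one_iff]
    have : (∑ i, x i) / T ≤ n := by
      rw [div_le_iff₀ hT]
      exact hs
    simpa using this
  have h3 := h1.trans h2
  rw [div_le_one (by positivity)] at h3
  simpa using h3

open scoped ComplexOrder in
lemma det_aux (n : ℕ) (M : Matrix (Fin n) (Fin n) ℂ) (T : ℝ) (hT : 0 < T)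
    (hM : ∀ i, ∑ j, ‖M i j‖ ^ 2 ≤ T) : ‖M.det‖ ^ 2 ≤ T ^ n := by
  have hP := Matrix.posSemidef_self_mul_conjTranspose M
  have hH := hP.isHermitian
  have hdet : ‖M.det‖ ^ 2 = ∏ i, hH.eigenvalues i := by
    have h := hH.det_eq_prod_eigenvalues
    rw [Matrix.det_mul, Matrix.det_conjTranspose] at h
    have h' : M.det * star M.det = ((‖M.det‖ ^ 2 : ℝ) : ℂ) := by
      have := Complex.mul_conj' M.det
      simpa using this
    rw [h'] at h
    have h2 : ((‖M.det‖ ^ 2 : ℝ) : ℂ) = ((∏ i, hH.eigenvalues i : ℝ) : ℂ) := by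
      rw [h]; simp
    exact_mod_cast h2
  have htr : ∑ i, hH.eigenvalues i = ∑ i, ∑ j, ‖M i j‖ ^ 2 := by
    have h := hH.trace_eq_sum_eigenvalues
    have h' : (M * Mᴴ).trace = ((∑ i, ∑ j, ‖M i j‖ ^ 2 : ℝ) : ℂ) := by
      simp only [Matrix.trace, Matrix.diag, Matrix.mul_apply, Matrix.conjTranspose_apply]
      push_cast
      refine Finset.sum_congr rfl fun i _ => Finset.sum_congr rfl fun j _ => ?_
      simpa using Complex.mul_conj' (M i j)
    rw [h'] at h
    have h2 : ((∑ i, ∑ j, ‖M i j‖ ^ 2 : ℝ) : ℂ) = ((∑ i, hH.eigenvalues i : ℝ) : ℂ) := by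
      rw [h]; simp
    exact (by exact_mod_cast h2.symm)
  rw [hdet]
  apply amgm_aux n _ T hT (fun i => hP.eigenvalues_nonneg i)
  rw [htr]
  calc ∑ i, ∑ j, ‖M i j‖ ^ 2 ≤ ∑ i : Fin n, T := Finset.sum_le_sum fun i _ => hM i
    _ = n * T := by simp

lemma iteratedDeriv_aux (p : ℂ[X]) (k : ℕ) :
    iteratedDeriv k (fun z => p.eval z) = fun z => ((derivative^[k]) p).eval z := by
  induction k with
  | zero => simp
  | succ k ih =>
    rw [iteratedDeriv_succ, ih]
    ext z
    rw [Polynomial.deriv, Function.iterate_succ_apply']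

lemma coeff_aux (p : ℂ[X]) (C : ℝ) (hC : ∀ z : ℂ, ‖z‖ = 1 → ‖p.eval z‖ ≤ C) (k : ℕ) :
    ‖p.coeff k‖ ≤ C := by
  have h := Complex.norm_iteratedDeriv_le_of_forall_mem_sphere_norm_le (c := 0) (R := 1) (C := C)
    (f := fun z => p.eval z) k one_pos p.differentiable.diffContOnCl
    (fun z hz => hC z (by simpa using hz))
  rw [iteratedDeriv_aux] at h
  have h0 : ((derivative^[k]) p).eval 0 = (k.factorial : ℂ) * p.coeff k := by
    rw [← Polynomial.coeff_zero_eq_eval_zero, Polynomial.coeff_iterate_derivative]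
    simp [Nat.descFactorial_self]
  beta_reduce at h
  rw [h0] at h
  simp only [norm_mul, one_pow, div_one, Complex.norm_natCast] at h
  exact le_of_mul_le_mul_left h (by exact_mod_cast Nat.factorial_pos k)

lemma row_aux (n : ℕ) (A : Matrix (Fin n) (Fin n) ℤ) (B : ℤ) (hB : 1 < B)
    (hA : ∀ i j, |A i j| ≤ B) (z : ℂ) (hz : ‖z‖ = 1) (i : Fin n) :
    ∑ j, ‖(Matrix.scalar (Fin n) z - A.map (Int.castRingHom ℂ)) i j‖ ^ 2
      ≤ n * (B : ℝ) ^ 2 + (2 * B + 1) := by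
  have hA' : ∀ i j, ‖(A i j : ℂ)‖ ≤ B := by
    intro i j
    rw [Complex.norm_intCast]
    exact_mod_cast hA i j
  have hB' : (1 : ℝ) < B := by exact_mod_cast hB
  calc _ ≤ ∑ j, ((B : ℝ) ^ 2 + if i = j then (2 * (B : ℝ) + 1) else 0) := by
        refine Finset.sum_le_sum fun j _ => ?_
        by_cases hij : i = j
        · subst hij
          have h1 : ‖z - (A i i : ℂ)‖ ≤ 1 + B :=
            (norm_sub_le _ _).trans (by rw [hz]; linarith [hA' i i])
          have h2 : ‖z - (A i i : ℂ)‖ ^ 2 ≤ (1 + (B : ℝ)) ^ 2 :=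
            pow_le_pow_left₀ (norm_nonneg _) h1 2
          simp
          linarith
        · have h2 : ‖(A i j : ℂ)‖ ^ 2 ≤ (B : ℝ) ^ 2 :=
            pow_le_pow_left₀ (norm_nonneg _) (hA' i j) 2
          simpa [Matrix.diagonal_apply_ne _ hij, hij] using h2
    _ = _ := by simp [Finset.sum_add_distrib]

theorem charpoly_coeff_bit_bound (n : ℕ) (hn : 4 ≤ n)
    (A : Matrix (Fin n) (Fin n) ℤ) (B : ℤ) (hB : 1 < B)
    (hA : ∀ i j, |A i j| ≤ B) (i : ℕ) :
    (|A.charpoly.coeff i| : ℝ) <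
      2 ^ ⌈((n : ℝ) / 2) * (Real.logb 2 n + Real.logb 2 ((B : ℝ) ^ 2) + 1.6669)⌉ := by
  have hB' : (2 : ℝ) ≤ B := by exact_mod_cast hB
  have hn' : (4 : ℝ) ≤ n := by exact_mod_cast hn
  set T : ℝ := n * (B : ℝ) ^ 2 + (2 * B + 1) with hTdef
  have hT : 0 < T := by positivity
  have hc : |(A.charpoly.coeff i : ℝ)| ≤ Real.sqrt (T ^ n) := by
    have h := coeff_aux (A.map (Int.castRingHom ℂ)).charpoly (Real.sqrt (T ^ n)) (fun z hz => by
      rw [Matrix.eval_charpoly]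
      apply Real.le_sqrt_of_sq_le
      exact det_aux n _ T hT (row_aux n A B hB hA z hz)) i
    rw [Matrix.charpoly_map, Polynomial.coeff_map] at h
    simpa [Complex.norm_intCast] using h
  have hTlt : T < 2 * (n * (B : ℝ) ^ 2) := by
    rw [hTdef]
    nlinarith [mul_le_mul_of_nonneg_right hn' (sq_nonneg (B : ℝ))]
  set x : ℝ := ((n : ℝ) / 2) * (Real.logb 2 n + Real.logb 2 ((B : ℝ) ^ 2) + 1.6669) with hx
  have hpow : (2 : ℝ) ^ x ≤ 2 ^ ⌈x⌉ := by
    rw [← Real.rpow_intCast]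
    exact Real.rpow_le_rpow_of_exponent_le (by norm_num) (Int.le_ceil x)
  refine lt_of_lt_of_le (lt_of_le_of_lt hc ?_) hpow
  rw [Real.sqrt_lt' (by positivity)]
  have hsq : ((2 : ℝ) ^ x) ^ 2
      = ((2 : ℝ) ^ (Real.logb 2 n + Real.logb 2 ((B : ℝ) ^ 2) + 1.6669)) ^ n := by
    rw [← Real.rpow_mul_natCast (by norm_num), ← Real.rpow_mul_natCast (by norm_num), hx]
    congr 1
    push_cast
    ring
  rw [hsq]
  apply pow_lt_pow_left₀ _ hT.le (by omega)
  refine hTlt.trans_le ?_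
  rw [Real.rpow_add (by norm_num), Real.rpow_add (by norm_num),
    Real.rpow_logb (by norm_num) (by norm_num) (by positivity),
    Real.rpow_logb (by norm_num) (by norm_num) (by positivity), mul_comm]
  have h2 : (2 : ℝ) ≤ 2 ^ (1.6669 : ℝ) := by
    have := Real.rpow_le_rpow_of_exponent_le (x := 2) (by norm_num)
      (show (1 : ℝ) ≤ 1.6669 by norm_num)
    simpa using this
  exact mul_le_mul_of_nonneg_left h2 (by positivity)
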